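/- Let R be a field containing an element of infinite multiplicative order, and let x be an indeterminate over R. Then any two polynomials ℓ, ℓ' ∈ R[x] of degree 1 are 4-connected through degree-1 polynomials: there exist l₁, l₂, l₃ ∈ R[x] of degree 1 such that ℓ ∼ l₁, l₁ ∼ l₂, l₂ ∼ l₃, and l₃ ∼ ℓ'. -/

import Mathlib

open Polynomial

/-- Two elements `a, b` of a commutative ring are 1-connected (`a ∼ b`) if for all
positive integers `m, n`, `a - b ∣ a^m - b^n` implies `m = n`. -/
def OneConnected {S : Type*} [CommRing S] (a b : S) : Prop :=
  ∀ m n : ℕ, 0 < m → 0 < n → (a - b) ∣ (a ^ m - b ^ n) → m = n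

lemma pow_injective_of_forall_pow_ne_one {R : Type*} [Field R] {u : R} (hu : u ≠ 0)
    (h : ∀ n : ℕ, 1 ≤ n → u ^ n ≠ 1) : Function.Injective (fun n : ℕ => u ^ n) := by
  have key : ∀ m n : ℕ, u ^ m = u ^ n → ¬ m < n := by
    intro m n hmn hlt
    refine h (n - m) (by omega) (mul_left_cancel₀ (pow_ne_zero m hu) ?_)
    rw [← pow_add, Nat.add_sub_cancel' hlt.le, mul_one, hmn]
  intro m n hmn
  have h1 := key m n hmn
  have h2 := key n m hmn.symm
  omega

/-- Polynomials taking a common value `u ^ k` of infinite order at some point are 1-connected. -/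
lemma OneConnected.of_eval_eq_pow {R : Type*} [Field R] {u : R}
    (hu : Function.Injective (fun n : ℕ => u ^ n)) {k : ℕ} (hk : 0 < k) {a b : R[X]} {t : R}
    (ha : a.eval t = u ^ k) (hb : b.eval t = u ^ k) : OneConnected a b := by
  rintro m n - - ⟨q, hq⟩
  have h := congrArg (eval t) hq
  simp only [eval_sub, eval_pow, eval_mul, ha, hb, sub_self, zero_mul, ← pow_mul] at h
  exact Nat.eq_of_mul_eq_mul_left hk (hu (sub_eq_zero.mp h))

lemma exists_eval_eq_of_degree_eq_one {R : Type*} [Field R] {p : R[X]} (hp : p.degree = 1)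
    (c : R) : ∃ t, p.eval t = c := by
  obtain ⟨t, ht⟩ := exists_root_of_degree_eq_one (p := p - C c)
    (by rw [degree_sub_C (by rw [hp]; exact zero_lt_one), hp])
  exact ⟨t, by simpa [sub_eq_zero] using ht⟩

lemma exists_degree_eq_one_eval_eq {R : Type*} [Field R] {s t c d : R} (hst : s ≠ t)
    (hcd : c ≠ d) : ∃ l : R[X], l.degree = 1 ∧ l.eval s = c ∧ l.eval t = d := by
  have hts : t - s ≠ 0 := sub_ne_zero.mpr hst.symm
  refine ⟨C ((d - c) / (t - s)) * X + C (c - (d - c) / (t - s) * s),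
    degree_linear (div_ne_zero (sub_ne_zero.mpr hcd.symm) hts), by simp, ?_⟩
  simp only [eval_add, eval_mul, eval_C, eval_X]
  field_simp
  ring

/-- If the field `R` has an element of infinite multiplicative order, then any two
degree-one polynomials `ℓ, ℓ' ∈ R[x]` are 4-connected through degree-one polynomials. -/
theorem stmt_13 {R : Type*} [Field R]
    (hR : ∃ a : R, a ≠ 0 ∧ ∀ n : ℕ, 1 ≤ n → a ^ n ≠ 1)
    (ℓ ℓ' : R[X]) (hℓ : ℓ.degree = 1) (hℓ' : ℓ'.degree = 1) :
    ∃ l₁ l₂ l₃ : R[X], l₁.degree = 1 ∧ l₂.degree = 1 ∧ l₃.degree = 1 ∧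
      OneConnected ℓ l₁ ∧ OneConnected l₁ l₂ ∧ OneConnected l₂ l₃ ∧
        OneConnected l₃ ℓ' := by
  obtain ⟨u, hu0, hu1⟩ := hR
  have hu := pow_injective_of_forall_pow_ne_one hu0 hu1
  obtain ⟨s, hs⟩ := exists_eval_eq_of_degree_eq_one hℓ (u ^ 1)
  obtain ⟨k, hk, t, ht, hst⟩ : ∃ k : ℕ, 1 < k ∧ ∃ t, ℓ'.eval t = u ^ k ∧ s ≠ t := by
    obtain ⟨t₂, h₂⟩ := exists_eval_eq_of_degree_eq_one hℓ' (u ^ 2)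
    obtain ⟨t₃, h₃⟩ := exists_eval_eq_of_degree_eq_one hℓ' (u ^ 3)
    by_cases h : s = t₂
    · refine ⟨3, by norm_num, t₃, h₃, fun h' => ?_⟩
      rw [← h, h', h₃] at h₂
      exact absurd (hu h₂) (by norm_num)
    · exact ⟨2, by norm_num, t₂, h₂, h⟩
  obtain ⟨l, hl, hls, hlt⟩ :=
    exists_degree_eq_one_eval_eq hst (fun h => hk.ne (hu h) : u ^ 1 ≠ u ^ k)
  have hk0 : 0 < k := by omega
  exact ⟨l, ℓ', ℓ', hl, hℓ', hℓ', .of_eval_eq_pow hu one_pos hs hls,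
    .of_eval_eq_pow hu hk0 hlt ht, .of_eval_eq_pow hu hk0 ht ht, .of_eval_eq_pow hu hk0 ht ht⟩
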